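/- Let C = C_{t₁} ⊕ C_{t₂} ⊕ ⋯ ⊕ C_{t_U} be a quasi-cyclic code of length lm and index l over F_q, where 0 ≤ t₁ < t₂ < ⋯ < t_U ≤ s, each C_{t_j} is a linear code over R_m ε_{t_j} of length l which, as an F_q-code, is an [lm, K_{t_j}] quasi-cyclic code, and the primitive idempotent ε_{t_j} corresponds to the q-cyclotomic coset {i_{t_j}, i_{t_j}q, …, i_{t_j}q^{k_{t_j}−1}} modulo m. Then the number of orbits of ⟨ρ^l⟩ on C* = C \ {0} is equal to N = Σ_{∅ ≠ {j₁ < j₂ < ⋯ < j_u} ⊆ {1,…,U}} gcd(m, i_{t_{j₁}}, i_{t_{j₂}}, …, i_{t_{j_u}})·∏_{v=1}^{u}(q^{K_{t_{j_v}}} − 1)/m, the sum running over all nonempty subsets of {1, 2, …, U}. In particular, s(C) ≤ N, with equality if and only if for any two codewords c₁, c₂ ∈ C* with the same Hamming weight there exists an integer i such that ρ^{il}(c₁) = c₂. -/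

import Mathlib

/-- The shift `ρ^l` on `F^{lm}`, with a codeword indexed as `c (i, j) = c_{ij}`
(`i ∈ ZMod m` the block index, `j ∈ Fin l` the position inside a block):
`(ρ^l c) (i, j) = c (i - 1, j)`. -/
noncomputable def shiftQC (F : Type*) [Field F] (m l : ℕ) :
    ((ZMod m × Fin l) → F) ≃ₗ[F] ((ZMod m × Fin l) → F) :=
  LinearEquiv.funCongrLeft F F ((Equiv.subRight (1 : ZMod m)).prodCongr (Equiv.refl (Fin l)))

/-- The `q`-cyclotomic coset of `i_t` modulo `m`, viewed inside `ZMod m`. -/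
def cycCoset (q m it : ℕ) : Set (ZMod m) :=
  {j | ∃ r : ℕ, j = (it : ZMod m) * (q : ZMod m) ^ r}

/-- Evaluation of the polynomial `Σ_i c_i x^i ∈ R_m = F[x]/(x^m - 1)` at `ζ^j`, computed in
an extension field `E` of `F` containing the primitive `m`-th root of unity `ζ`. -/
noncomputable def evalDFT {F E : Type*} [Field F] [Field E] [Algebra F E] {m : ℕ} [NeZero m]
    (ζ : E) (c : ZMod m → F) (j : ZMod m) : E :=
  ∑ i : ZMod m, algebraMap F E (c i) * ζ ^ (i * j).val

/-- `Σ_i c_i x^i` lies in the minimal ideal `R_m ε_t` of `R_m` associated with the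
`q`-cyclotomic coset of `i_t`, i.e. it vanishes at `ζ^j` for every `j` outside the coset. -/
def inMinIdeal {F E : Type*} [Field F] [Field E] [Algebra F E] (q : ℕ) {m : ℕ} [NeZero m]
    (ζ : E) (it : ℕ) (c : ZMod m → F) : Prop :=
  ∀ j : ZMod m, j ∉ cycCoset q m it → evalDFT ζ c j = 0

lemma evalDFT_eq_sum {F E : Type*} [Field F] [Field E] [Algebra F E] {m : ℕ} [NeZero m]
    {ζ : E} (hζ : IsPrimitiveRoot ζ m) (c : ZMod m → F) (j : ZMod m) :
    evalDFT ζ c j =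
      ∑ i, algebraMap F E (c i) * AddChar.zmodChar m hζ.pow_eq_one (i * j) := by
  simp [evalDFT, AddChar.zmodChar_apply]

lemma evalDFT_translate {F E : Type*} [Field F] [Field E] [Algebra F E] {m : ℕ} [NeZero m]
    {ζ : E} (hζ : IsPrimitiveRoot ζ m) (c : ZMod m → F) (a j : ZMod m) :
    evalDFT ζ (fun i => c (i - a)) j = ζ ^ (a * j).val * evalDFT ζ c j := by
  rw [evalDFT_eq_sum hζ, evalDFT_eq_sum hζ, ← AddChar.zmodChar_apply hζ.pow_eq_one,
    Finset.mul_sum, ← Equiv.sum_comp (Equiv.addRight a)]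
  refine Finset.sum_congr rfl fun i _ => ?_
  simp only [Equiv.coe_addRight, add_sub_cancel_right, add_mul, AddChar.map_add_eq_mul]
  ring

lemma evalDFT_sum {F E ι : Type*} [Field F] [Field E] [Algebra F E] {m : ℕ} [NeZero m]
    (ζ : E) (s : Finset ι) (f : ι → ZMod m → F) (j : ZMod m) :
    evalDFT ζ (fun i => ∑ k ∈ s, f k i) j = ∑ k ∈ s, evalDFT ζ (f k) j := by
  simp only [evalDFT, map_sum, Finset.sum_mul]
  exact Finset.sum_comm

lemma evalDFT_sub {F E : Type*} [Field F] [Field E] [Algebra F E] {m : ℕ} [NeZero m]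
    (ζ : E) (c d : ZMod m → F) (j : ZMod m) :
    evalDFT ζ (fun i => c i - d i) j = evalDFT ζ c j - evalDFT ζ d j := by
  simp [evalDFT, sub_mul]

lemma eq_zero_of_evalDFT_eq_zero {F E : Type*} [Field F] [Field E] [Algebra F E] {m : ℕ}
    [NeZero m] {ζ : E} (hζ : IsPrimitiveRoot ζ m) {c : ZMod m → F}
    (h : ∀ j, evalDFT ζ c j = 0) : c = 0 := by
  classical
  funext k
  have hψ := AddChar.zmodChar_primitive_of_primitive_root m hζ
  have hm : (m : E) ≠ 0 := (hζ.neZero').ne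
  have key : ∑ j, AddChar.zmodChar m hζ.pow_eq_one (-(k * j)) * evalDFT ζ c j
      = algebraMap F E (c k) * m := by
    simp only [evalDFT_eq_sum hζ, Finset.mul_sum]
    rw [Finset.sum_comm]
    have : ∀ i : ZMod m, ∑ j, AddChar.zmodChar m hζ.pow_eq_one (-(k * j)) *
        (algebraMap F E (c i) * AddChar.zmodChar m hζ.pow_eq_one (i * j)) =
        algebraMap F E (c i) * if i - k = 0 then (m : E) else 0 := by
      intro i
      have := AddChar.sum_mulShift (i - k) hψ
      rw [ZMod.card] at this
      rw [Nat.cast_ite, Nat.cast_zero] at this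
      rw [← this, Finset.mul_sum]
      refine Finset.sum_congr rfl fun j _ => ?_
      rw [mul_left_comm, ← AddChar.map_add_eq_mul]
      congr 2
      ring
    simp [this, sub_eq_zero]
  simp only [h, mul_zero, Finset.sum_const_zero] at key
  simpa [hm] using key.symm

lemma shiftQC_zpow_apply {F : Type*} [Field F] {m l : ℕ} (z : ℤ) (c : ZMod m × Fin l → F)
    (i : ZMod m) (v : Fin l) : (shiftQC F m l ^ z) c (i, v) = c (i - z, v) := by
  have h1 : ∀ c : ZMod m × Fin l → F, ∀ i v, shiftQC F m l c (i, v) = c (i - 1, v) :=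
    fun _ _ _ => rfl
  have h2 : ∀ c : ZMod m × Fin l → F, ∀ i v, (shiftQC F m l)⁻¹ c (i, v) = c (i + 1, v) := by
    intro c i v
    have := h1 ((shiftQC F m l)⁻¹ c) (i + 1) v
    rw [← LinearEquiv.mul_apply, mul_inv_cancel] at this
    simpa using this.symm
  induction z generalizing c i with
  | zero => simp
  | succ n ih => rw [zpow_add_one, LinearEquiv.mul_apply, ih, h1]; push_cast; congr 2; ring
  | pred n ih => rw [zpow_sub_one, LinearEquiv.mul_apply, ih, h2]; push_cast; congr 2; ring

lemma hammingNorm_shiftQC_zpow {F : Type*} [Field F] [DecidableEq F] {m l : ℕ} [NeZero m]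
    (z : ℤ) (c : ZMod m × Fin l → F) : hammingNorm ((shiftQC F m l ^ z) c) = hammingNorm c := by
  unfold hammingNorm
  refine Finset.card_equiv
    ((Equiv.subRight (z : ZMod m)).prodCongr (Equiv.refl (Fin l))) fun ⟨i, v⟩ => ?_
  simp [shiftQC_zpow_apply]

lemma mem_cycCoset_of_mem {q m a : ℕ} [NeZero m] (hq : m.Coprime q) {k : ZMod m}
    (hk : k ∈ cycCoset q m a) : ∃ r : ℕ, (a : ZMod m) = k * (q : ZMod m) ^ r := by
  obtain ⟨r, rfl⟩ := hk
  refine ⟨r * (m.totient - 1), ?_⟩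
  have h1 : (q : ZMod m) ^ m.totient = 1 := by
    have := congrArg Units.val (ZMod.pow_totient (ZMod.unitOfCoprime q hq.symm))
    rwa [Units.val_pow_eq_pow_val, ZMod.coe_unitOfCoprime, Units.val_one] at this
  have hpos : 0 < m.totient := Nat.totient_pos.2 (NeZero.pos m)
  have h2 : r + r * (m.totient - 1) = m.totient * r := by
    obtain ⟨t, ht⟩ := Nat.exists_eq_add_of_lt hpos
    rw [ht]; simp; ring
  rw [mul_assoc, ← pow_add, h2, pow_mul, h1, one_pow, mul_one]

lemma cycCoset_eq_of_mem {q m a b : ℕ} [NeZero m] (hq : m.Coprime q) {k : ZMod m}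
    (ha : k ∈ cycCoset q m a) (hb : k ∈ cycCoset q m b) : cycCoset q m a = cycCoset q m b := by
  have key : ∀ {a b : ℕ}, k ∈ cycCoset q m a → k ∈ cycCoset q m b →
      cycCoset q m a ⊆ cycCoset q m b := by
    rintro a b ha ⟨s, hs⟩ _ ⟨t, rfl⟩
    obtain ⟨r, hr⟩ := mem_cycCoset_of_mem hq ha
    exact ⟨s + r + t, by rw [hr, hs]; ring⟩
  exact (key ha hb).antisymm (key hb ha)

lemma shiftQC_zpow_eq_self_iff {F E : Type*} [Field F] [Field E] [Algebra F E] {q m l a : ℕ}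
    [NeZero m] (hq : m.Coprime q) {ζ : E} (hζ : IsPrimitiveRoot ζ m) {c : ZMod m × Fin l → F}
    (hc : ∀ v, inMinIdeal q ζ a (fun i : ZMod m => c (i, v))) (hc0 : c ≠ 0) (z : ℤ) :
    (shiftQC F m l ^ z) c = c ↔ (z : ZMod m) * a = 0 := by
  have hval : ∀ x : ZMod m, ζ ^ x.val = 1 ↔ x = 0 := by
    intro x
    rw [hζ.pow_eq_one_iff_dvd]
    constructor
    · intro h
      exact (ZMod.val_eq_zero x).1 (Nat.eq_zero_of_dvd_of_lt h (ZMod.val_lt x))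
    · rintro rfl; simp
  constructor
  · intro h
    obtain ⟨v, k, hk⟩ : ∃ v k, evalDFT ζ (fun i : ZMod m => c (i, v)) k ≠ 0 := by
      by_contra! hcon
      refine hc0 (funext fun ⟨i, v⟩ => ?_)
      exact congrFun (eq_zero_of_evalDFT_eq_zero hζ (hcon v)) i
    have hka : k ∈ cycCoset q m a := by_contra fun hn => hk (hc v k hn)
    obtain ⟨r, hr⟩ := mem_cycCoset_of_mem hq hka
    have ht := evalDFT_translate hζ (fun i : ZMod m => c (i, v)) (z : ZMod m) k
    have : (fun i : ZMod m => c (i - (z : ZMod m), v)) = fun i => c (i, v) := by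
      funext i
      rw [← shiftQC_zpow_apply z c, h]
    rw [this] at ht
    have h1 : ζ ^ ((z : ZMod m) * k).val = 1 := by
      have := mul_right_cancel₀ hk ((one_mul _).trans ht)
      exact this.symm
    rw [hr, ← mul_assoc, (hval _).1 h1, zero_mul]
  · intro h
    funext ⟨i, v⟩
    have hz : (fun i : ZMod m => c (i - (z : ZMod m), v) - c (i, v)) = 0 := by
      refine eq_zero_of_evalDFT_eq_zero hζ fun k => ?_
      rw [evalDFT_sub, evalDFT_translate hζ (fun i : ZMod m => c (i, v))]
      by_cases hk : k ∈ cycCoset q m a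
      · obtain ⟨r, rfl⟩ := hk
        simp [← mul_assoc, h]
      · simp [hc v k hk]
    rw [shiftQC_zpow_apply]
    exact sub_eq_zero.1 (congrFun hz i)

lemma eq_zero_of_sum_eq_zero_of_inMinIdeal {F E ι : Type*} [Field F] [Field E] [Algebra F E]
    [Fintype ι] {q m l : ℕ} [NeZero m] (hq : m.Coprime q) {ζ : E} (hζ : IsPrimitiveRoot ζ m)
    {a : ι → ℕ} (ha : ∀ j j', j ≠ j' → cycCoset q m (a j) ≠ cycCoset q m (a j'))
    {f : ι → ZMod m × Fin l → F}
    (hf : ∀ j v, inMinIdeal q ζ (a j) (fun i : ZMod m => f j (i, v))) (h : ∑ j, f j = 0) (j : ι) :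
    f j = 0 := by
  classical
  funext ⟨i, v⟩
  refine congrFun (eq_zero_of_evalDFT_eq_zero hζ (c := fun i : ZMod m => f j (i, v))
    fun k => ?_) i
  by_cases hk : k ∈ cycCoset q m (a j)
  · have hs := evalDFT_sum ζ Finset.univ (fun j (i : ZMod m) => f j (i, v)) k
    have h0 : (fun i : ZMod m => ∑ j, f j (i, v)) = fun _ => 0 := by
      funext i
      simpa using congrFun h (i, v)
    rw [h0, Finset.sum_eq_single j] at hs
    · rw [← hs]; simp [evalDFT]
    · intro j' _ hj'
      exact hf j' v k fun hk' => ha _ _ hj' (cycCoset_eq_of_mem hq hk' hk)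
    · simp
  · exact hf j v k hk

lemma ncard_range_of_eq_iff_dvd {α : Type*} {d : ℕ} (hd : 0 < d) {g : ℤ → α}
    (hg : ∀ z w, g z = g w ↔ (d : ℤ) ∣ z - w) : (Set.range g).ncard = d := by
  have : Set.range g = (fun n : ℕ => g n) '' (Finset.range d : Set ℕ) := by
    ext x
    constructor
    · rintro ⟨z, rfl⟩
      have hd' : (d : ℤ) ≠ 0 := by exact_mod_cast hd.ne'
      have h0 := Int.emod_nonneg z hd'
      have h1 := Int.emod_lt_of_pos z (by exact_mod_cast hd : (0 : ℤ) < d)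
      refine ⟨(z % d).toNat, by simp; omega, ?_⟩
      simp only [Int.toNat_of_nonneg h0]
      rw [hg]
      exact ⟨-(z / d), by have := Int.emod_add_mul_ediv z d; linarith⟩
    · rintro ⟨n, _, rfl⟩
      exact ⟨n, rfl⟩
  rw [this, Set.InjOn.ncard_image, Set.ncard_coe_finset, Finset.card_range]
  intro x hx y hy hxy
  simp only [Finset.coe_range, Set.mem_Iio] at hx hy
  have h := (hg _ _).1 hxy
  have := Int.eq_zero_of_abs_lt_dvd h (by rw [abs_lt]; omega)
  omega

lemma forall_intCast_mul_eq_zero_iff {ι : Type*} {m : ℕ} [NeZero m] (S : Finset ι) (a : ι → ℕ)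
    (z : ℤ) : (∀ j ∈ S, (z : ZMod m) * a j = 0) ↔ ((m / m.gcd (S.gcd a) : ℕ) : ℤ) ∣ z := by
  have h1 : ∀ j, (z : ZMod m) * a j = 0 ↔ m ∣ z.natAbs * a j := by
    intro j
    have : (z : ZMod m) * a j = ((z * a j : ℤ) : ZMod m) := by push_cast; rfl
    rw [this, ZMod.intCast_zmod_eq_zero_iff_dvd, ← Int.natCast_dvd_natCast, Int.natCast_mul,
      ← Int.dvd_natAbs, Int.natAbs_mul]
    simp
  simp only [h1]
  rw [← Finset.dvd_gcd_iff, Finset.gcd_mul_left, normalize_eq, Int.natCast_dvd]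
  have hg : 0 < m.gcd (S.gcd a) := Nat.gcd_pos_of_pos_left _ (NeZero.pos m)
  constructor
  · intro h
    have : m ∣ z.natAbs * m.gcd (S.gcd a) := by
      rw [← Nat.gcd_mul_left]
      exact Nat.dvd_gcd (dvd_mul_left _ _) h
    exact (Nat.div_dvd_iff_dvd_mul (Nat.gcd_dvd_left _ _) hg).2 (by rwa [mul_comm])
  · intro h
    have := (Nat.div_dvd_iff_dvd_mul (Nat.gcd_dvd_left _ _) hg).1 h
    rw [mul_comm] at this
    exact this.trans (mul_dvd_mul_left _ (Nat.gcd_dvd_right _ _))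

lemma card_image_eq_sum_inv {α β : Type*} [DecidableEq β] (s : Finset α) (f : α → β) :
    ((s.image f).card : ℚ) = ∑ x ∈ s, ((s.filter fun y => f y = f x).card : ℚ)⁻¹ := by
  rw [← Finset.sum_fiberwise_of_maps_to (t := s.image f) (g := f)
    fun x hx => Finset.mem_image_of_mem f hx]
  rw [Finset.card_eq_sum_ones, Nat.cast_sum]
  refine Finset.sum_congr rfl fun y hy => ?_
  obtain ⟨x, hx, rfl⟩ := Finset.mem_image.1 hy
  have : ∀ w ∈ s.filter (fun w => f w = f x),
      ((s.filter fun y => f y = f w).card : ℚ)⁻¹ = ((s.filter fun y => f y = f x).card : ℚ)⁻¹ := by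
    intro w hw
    rw [(Finset.mem_filter.1 hw).2]
  rw [Finset.sum_congr rfl this, Finset.sum_const, nsmul_eq_mul, mul_inv_cancel₀]
  · simp
  · have : 0 < (s.filter fun y => f y = f x).card :=
      Finset.card_pos.2 ⟨x, by simp [hx]⟩
    exact_mod_cast this.ne'

lemma card_filter_support_eq {ι : Type*} [Fintype ι] [DecidableEq ι] {M : ι → Type*}
    [∀ j, Fintype (M j)] [∀ j, DecidableEq (M j)] [∀ j, Zero (M j)] (S : Finset ι) :
    (Finset.univ.filter fun f : ∀ j, M j => (Finset.univ.filter fun j => f j ≠ 0) = S).card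
      = ∏ j ∈ S, (Fintype.card (M j) - 1) := by
  have : (Finset.univ.filter fun f : ∀ j, M j => (Finset.univ.filter fun j => f j ≠ 0) = S)
      = Fintype.piFinset fun j => if j ∈ S then Finset.univ.erase (0 : M j) else {0} := by
    ext f
    simp only [Finset.mem_filter, Finset.mem_univ, true_and, Fintype.mem_piFinset, Finset.ext_iff]
    refine forall_congr' fun j => ?_
    by_cases hj : j ∈ S <;> simp [hj]
  rw [this, Fintype.card_piFinset, ← Finset.prod_subset (Finset.subset_univ S)]
  · refine Finset.prod_congr rfl fun j hj => ?_
    rw [if_pos hj, Finset.card_erase_of_mem (Finset.mem_univ _), Finset.card_univ]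
  · intro j _ hj
    simp [hj]

lemma shiftQC_zpow_mem {F : Type*} [Field F] {m l : ℕ} [NeZero m]
    {D : Submodule F (ZMod m × Fin l → F)} (hD : ∀ c ∈ D, shiftQC F m l c ∈ D) (z : ℤ)
    {c : ZMod m × Fin l → F} (hc : c ∈ D) : (shiftQC F m l ^ z) c ∈ D := by
  have hnat : ∀ n : ℕ, (shiftQC F m l ^ (n : ℤ)) c ∈ D := by
    intro n
    induction n with
    | zero => simpa
    | succ n ih =>
      rw [zpow_natCast] at ih
      rw [zpow_natCast, pow_succ', LinearEquiv.mul_apply]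
      exact hD _ ih
  have hz : (shiftQC F m l ^ z) c = (shiftQC F m l ^ (((z : ZMod m).val : ℕ) : ℤ)) c := by
    funext ⟨i, v⟩
    simp [shiftQC_zpow_apply]
  rw [hz]
  exact hnat _

lemma range_shiftQC_zpow_eq_iff {F : Type*} [Field F] {m l : ℕ} (c d : ZMod m × Fin l → F) :
    (Set.range fun z : ℤ => (shiftQC F m l ^ z) c) = (Set.range fun z : ℤ => (shiftQC F m l ^ z) d)
      ↔ ∃ z : ℤ, (shiftQC F m l ^ z) c = d := by
  constructor
  · intro h
    have : d ∈ Set.range fun z : ℤ => (shiftQC F m l ^ z) d := ⟨0, by simp⟩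
    rwa [← h] at this
  · rintro ⟨z, rfl⟩
    ext x
    constructor
    · rintro ⟨w, rfl⟩
      exact ⟨w - z, by simp [← LinearEquiv.mul_apply, ← zpow_add]⟩
    · rintro ⟨w, rfl⟩
      exact ⟨w + z, by simp [← LinearEquiv.mul_apply, ← zpow_add]⟩

lemma ncard_image_le_and_eq_iff {α β γ : Type*} [Nonempty γ] {s : Set α} (hs : s.Finite)
    {f : α → γ} {g : α → β} (h : f.FactorsThrough g) :
    (f '' s).ncard ≤ (g '' s).ncard ∧
      ((f '' s).ncard = (g '' s).ncard ↔ ∀ x ∈ s, ∀ y ∈ s, f x = f y → g x = g y) := by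
  obtain ⟨e, rfl⟩ := (Function.factorsThrough_iff f).1 h
  rw [Set.image_comp]
  refine ⟨Set.ncard_image_le (hs.image g), ?_⟩
  rw [Set.ncard_image_iff (hs.image g)]
  simp [Set.InjOn]

/-- Let `C = C_{t₁} ⊕ ⋯ ⊕ C_{t_U}` be a quasi-cyclic code of length `lm`
and index `l` over `F_q`, each `C_{t_j}` an `[lm, K_{t_j}]` linear code over the minimal
ideal `R_m ε_{t_j}` (distinct cyclotomic cosets).  Then the number `N` of orbits of
`⟨ρ^l⟩` on `C \ {0}` equals
`Σ_{∅ ≠ S ⊆ {1,…,U}} gcd(m, (i_{t_j})_{j ∈ S}) ∏_{j ∈ S} (q^{K_{t_j}} - 1) / m`;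
in particular `s(C) ≤ N`, with equality iff any two nonzero codewords of the same weight
lie in the same `⟨ρ^l⟩`-orbit. -/
theorem orbits_shift_direct_sum {F E : Type*} [Field F] [Fintype F] [DecidableEq F]
    [Field E] [Algebra F E] {m l U : ℕ} [NeZero m] (hl : 2 ≤ l)
    (hco : Nat.Coprime m (Fintype.card F))
    (ζ : E) (hζ : IsPrimitiveRoot ζ m)
    (it K : Fin U → ℕ)
    (Ct : Fin U → Submodule F ((ZMod m × Fin l) → F))
    (hQC : ∀ j, ∀ c ∈ Ct j, shiftQC F m l c ∈ Ct j)
    (hmin : ∀ j, ∀ c ∈ Ct j, ∀ v : Fin l,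
      inMinIdeal (Fintype.card F) ζ (it j) (fun i : ZMod m => c (i, v)))
    (hK : ∀ j, Module.finrank F ↥(Ct j) = K j)
    (hdist : ∀ j j' : Fin U, j ≠ j' →
      cycCoset (Fintype.card F) m (it j) ≠ cycCoset (Fintype.card F) m (it j'))
    (C : Set ((ZMod m × Fin l) → F))
    (hCsum : C = {c | ∃ f : Fin U → ((ZMod m × Fin l) → F),
      (∀ j, f j ∈ Ct j) ∧ c = ∑ j : Fin U, f j})
    (N : ℕ)
    (hN : Set.ncard {O : Set ((ZMod m × Fin l) → F) | ∃ c, c ∈ C ∧ c ≠ 0 ∧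
      O = {x | ∃ z : ℤ, (shiftQC F m l ^ z) c = x}} = N) :
    (N : ℚ) = ∑ S : Finset (Fin U), (if S.Nonempty then
        ((Nat.gcd m (S.gcd it) * ∏ j ∈ S, (Fintype.card F ^ K j - 1) : ℕ) : ℚ) / (m : ℚ)
      else 0) ∧
    Set.ncard {w : ℕ | ∃ c, c ∈ C ∧ c ≠ 0 ∧ hammingNorm c = w} ≤ N ∧
    (Set.ncard {w : ℕ | ∃ c, c ∈ C ∧ c ≠ 0 ∧ hammingNorm c = w} = N ↔
      ∀ c₁ c₂ : (ZMod m × Fin l) → F, c₁ ∈ C → c₂ ∈ C → c₁ ≠ 0 → c₂ ≠ 0 →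
        hammingNorm c₁ = hammingNorm c₂ → ∃ z : ℤ, (shiftQC F m l ^ z) c₁ = c₂) := by
  classical
  have hmemC : ∀ c, c ∈ C ↔ ∃ f : ∀ j, Ct j, c = ∑ j, (f j : ZMod m × Fin l → F) := by
    intro c
    rw [hCsum]
    constructor
    · rintro ⟨f, hf, rfl⟩
      exact ⟨fun j => ⟨f j, hf j⟩, rfl⟩
    · rintro ⟨f, rfl⟩
      exact ⟨fun j => f j, fun j => (f j).2, rfl⟩
  set tot : (∀ j, Ct j) → (ZMod m × Fin l → F) := fun f => ∑ j, (f j : ZMod m × Fin l → F)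
    with htot
  set orb : (ZMod m × Fin l → F) → Set (ZMod m × Fin l → F) :=
    fun c => Set.range fun z : ℤ => (shiftQC F m l ^ z) c with horb
  have hinj : Function.Injective tot := by
    intro f g hfg
    funext j
    have h0 : ∑ j, ((f j - g j : Ct j) : ZMod m × Fin l → F) = 0 := by
      simpa [sub_eq_zero] using hfg
    have := eq_zero_of_sum_eq_zero_of_inMinIdeal hco hζ hdist
      (f := fun j => ((f j - g j : Ct j) : ZMod m × Fin l → F))
      (fun j v => hmin j _ (f j - g j).2 v) h0 j
    exact sub_eq_zero.1 (Subtype.ext this)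
  have htot0 : ∀ f, tot f = 0 ↔ f = 0 := by
    intro f
    rw [← hinj.eq_iff]
    simp [htot]
  let act : ℤ → (∀ j, Ct j) → ∀ j, Ct j :=
    fun z f j => ⟨(shiftQC F m l ^ z) (f j), shiftQC_zpow_mem (hQC j) z (f j).2⟩
  have hact : ∀ z f, (shiftQC F m l ^ z) (tot f) = tot (act z f) := by
    intro z f
    simp [htot, act]
  let supp : (∀ j, Ct j) → Finset (Fin U) := fun f => Finset.univ.filter fun j => f j ≠ 0
  have horbcard : ∀ f, (orb (tot f)).ncard = m / m.gcd ((supp f).gcd it) := by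
    intro f
    refine ncard_range_of_eq_iff_dvd (Nat.div_pos
      (Nat.gcd_le_left _ (NeZero.pos m)) (Nat.gcd_pos_of_pos_left _ (NeZero.pos m))) ?_
    intro z w
    have h1 : (shiftQC F m l ^ z) (tot f) = (shiftQC F m l ^ w) (tot f) ↔
        (shiftQC F m l ^ (z - w)) (tot f) = tot f := by
      conv_lhs => rw [← sub_add_cancel z w, add_comm, zpow_add, LinearEquiv.mul_apply]
      exact (shiftQC F m l ^ w).injective.eq_iff
    rw [h1, hact, hinj.eq_iff, ← forall_intCast_mul_eq_zero_iff, funext_iff]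
    refine forall_congr' fun j => ?_
    by_cases hj : f j = 0
    · have hfix : act (z - w) f j = f j := Subtype.ext (by
        change (shiftQC F m l ^ (z - w)) (f j : ZMod m × Fin l → F) = f j
        rw [hj, ZeroMemClass.coe_zero, map_zero])
      exact iff_of_true hfix fun hmem => absurd hj (Finset.mem_filter.1 hmem).2
    · simp only [supp, Finset.mem_filter, Finset.mem_univ, true_and, ne_eq, hj,
        not_false_eq_true, forall_true_left]
      rw [← shiftQC_zpow_eq_self_iff hco hζ (hmin j _ (f j).2) (by simpa using hj)]
      exact Subtype.ext_iff
  let s : Finset (∀ j, Ct j) := Finset.univ.filter fun f => f ≠ 0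
  have horbits : {O : Set ((ZMod m × Fin l) → F) | ∃ c, c ∈ C ∧ c ≠ 0 ∧
      O = {x | ∃ z : ℤ, (shiftQC F m l ^ z) c = x}} = orb '' {c | c ∈ C ∧ c ≠ 0} := by
    ext O
    simp only [Set.mem_ofPred_eq, Set.mem_image, and_assoc, horb]
    exact exists_congr fun c => and_congr_right fun _ => and_congr_right fun _ => eq_comm
  have hweights : {w : ℕ | ∃ c, c ∈ C ∧ c ≠ 0 ∧ hammingNorm c = w}
      = hammingNorm '' {c | c ∈ C ∧ c ≠ 0} := by
    ext w
    simp only [Set.mem_ofPred_eq, Set.mem_image, and_assoc]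
  have hcodewords : {c | c ∈ C ∧ c ≠ 0} = tot '' (s : Set (∀ j, Ct j)) := by
    ext c
    simp only [Set.mem_ofPred_eq, hmemC, Set.mem_image, s, Finset.coe_filter, Finset.mem_univ,
      true_and]
    constructor
    · rintro ⟨⟨f, rfl⟩, h⟩
      exact ⟨f, fun hf => h ((htot0 f).2 hf), rfl⟩
    · rintro ⟨f, hf, rfl⟩
      exact ⟨⟨f, rfl⟩, fun h => hf ((htot0 f).1 h)⟩
  rw [horbits] at hN
  have hfiber : ∀ f ∈ s, (s.filter fun g => orb (tot g) = orb (tot f)).card =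
      m / m.gcd ((supp f).gcd it) := by
    intro f hf
    rw [← horbcard, ← Set.ncard_coe_finset, ← Set.ncard_image_of_injective _ hinj]
    congr 1
    ext x
    simp only [Set.mem_image, Finset.mem_coe, Finset.mem_filter]
    constructor
    · rintro ⟨g, ⟨_, hg⟩, rfl⟩
      exact (range_shiftQC_zpow_eq_iff _ _).1 hg.symm
    · rintro ⟨z, rfl⟩
      refine ⟨act z f, ⟨?_, ((range_shiftQC_zpow_eq_iff _ _).2 ⟨z, hact z f⟩).symm⟩,
        (hact z f).symm⟩
      simp only [s, Finset.mem_filter, Finset.mem_univ, true_and] at hf ⊢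
      rw [ne_eq, ← htot0, ← hact]
      simpa [htot0] using hf
  refine ⟨?_, ?_⟩
  · have hNs : N = (s.image fun f => orb (tot f)).card := by
      rw [← hN, hcodewords, ← Set.image_comp, ← Set.ncard_coe_finset, Finset.coe_image]
      rfl
    have hinv : ∀ S : Finset (Fin U), ((m / m.gcd (S.gcd it) : ℕ) : ℚ)⁻¹
        = (m.gcd (S.gcd it) : ℚ) / m := by
      intro S
      have : (m.gcd (S.gcd it) : ℚ) ≠ 0 := by
        exact_mod_cast (Nat.gcd_pos_of_pos_left _ (NeZero.pos m)).ne'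
      rw [Nat.cast_div (Nat.gcd_dvd_left _ _) this, inv_div]
    have hsupp : ∀ f : ∀ j, Ct j, f ≠ 0 ↔ (supp f).Nonempty := by
      intro f
      simp [supp, Finset.filter_nonempty_iff, funext_iff]
    rw [hNs, card_image_eq_sum_inv, Finset.sum_congr rfl fun f hf => by rw [hfiber f hf, hinv],
      Finset.sum_filter, ← Finset.sum_fiberwise Finset.univ supp]
    refine Finset.sum_congr rfl fun S _ => ?_
    have hcard : ∀ j, Fintype.card (Ct j) = Fintype.card F ^ K j := by
      intro j
      rw [Module.card_eq_pow_finrank (K := F), hK]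
    have hS := card_filter_support_eq (M := fun j => Ct j) S
    simp only [hcard] at hS
    have hconst : ∀ f ∈ Finset.univ.filter (fun f => supp f = S),
        (if f ≠ 0 then (m.gcd ((supp f).gcd it) : ℚ) / m else 0) =
          if S.Nonempty then (m.gcd (S.gcd it) : ℚ) / m else 0 := by
      intro f hf
      simp only [hsupp, (Finset.mem_filter.1 hf).2]
    rw [Finset.sum_congr rfl hconst, Finset.sum_const, hS, nsmul_eq_mul]
    split_ifs
    · rw [Nat.cast_mul]
      ring
    · simp
  · have hfac : (hammingNorm : (ZMod m × Fin l → F) → ℕ).FactorsThrough orb := by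
      intro c d h
      obtain ⟨z, rfl⟩ := (range_shiftQC_zpow_eq_iff _ _).1 h
      exact (hammingNorm_shiftQC_zpow z c).symm
    obtain ⟨hle, heq⟩ := ncard_image_le_and_eq_iff (Set.toFinite {c | c ∈ C ∧ c ≠ 0}) hfac
    rw [hweights, ← hN]
    refine ⟨hle, heq.trans ?_⟩
    simp only [horb, range_shiftQC_zpow_eq_iff]
    exact ⟨fun h c₁ c₂ h₁ h₂ n₁ n₂ => h c₁ ⟨h₁, n₁⟩ c₂ ⟨h₂, n₂⟩,
      fun h c₁ h₁ c₂ h₂ => h c₁ c₂ h₁.1 h₂.1 h₁.2 h₂.2⟩
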